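/- arXiv:1607.02879 — 7 statements merged into one kernel-verified Lean document; each statement's English description precedes it below -/
import Mathlib

section
/- For every real number x with 1/2 < x < 1, it holds that x/(2−x) < (3x−1)/(1+x) and (3x−1)/(1+x) < x. (Thus, in a two-party vote transfer system in which the majority party wins all single-seat districts, the majority party's preference order on vote transfer formulas by its list vote share is DVT ≻ NVT ≻ PVT.) -/
/-- Majority party wins all districts: preference order DVT ≻ NVT ≻ PVT,
i.e. x/(2−x) < (3x−1)/(1+x) and (3x−1)/(1+x) < x. -/
theorem stmt_0 (x : ℝ) (hx1 : 1/2 < x) (hx2 : x < 1) :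
    x / (2 - x) < (3*x - 1) / (1 + x) ∧ (3*x - 1) / (1 + x) < x := by
  constructor
  · rw [div_lt_div_iff₀ (by linarith) (by linarith)]
    nlinarith [mul_pos (sub_pos.2 hx1) (sub_pos.2 hx2)]
  · rw [div_lt_iff₀ (by linarith)]
    nlinarith [mul_pos (sub_pos.2 hx2) (sub_pos.2 hx2)]
end

section
/- Let h > 0 and k be real numbers with 1/2 < k < 1/2 + h and k + h < 1. Define π = 1/2 + (k−1/2)/(2h), β = (1/2+k+h)/2, γ = (1/2+k−h)/2, Δ = k+h−1/2, ∇ = 1/2−k+h. Then (k + (1−π)γ) / (1 + (1−π)γ + π(1−β)) < (k + (1−π)γ + πΔ) / (1 + (1−π)γ + π(1−β) + πΔ + (1−π)∇), i.e. the majority party's expected list vote share under PVT is strictly smaller than under NVT. -/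
/-- The polynomial inequality behind the comparison, in terms of the expected vote differences
`p` and `q` in a district won and lost. -/
theorem sq_mul_lt_sq_mul_of_add_lt_one {p q : ℝ} (hq : 0 < q) (hqp : q < p) (hpq : p + q < 1) :
    q ^ 2 * (p + 2 * q + p ^ 2 - 2 * q ^ 2) < p ^ 2 * (2 * p + q + q ^ 2 - 2 * p ^ 2) := by
  have hp : 0 < p := hq.trans hqp
  have hfactor : 0 < 3 * p * q + 2 * (1 - (p + q)) * (p ^ 2 + q ^ 2) := by
    have : 0 < 1 - (p + q) := sub_pos.2 hpq
    positivity
  nlinarith [mul_pos (sub_pos.2 hqp) hfactor]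

/-- Uniform vote shares: expected list vote share under PVT is smaller than under NVT. -/
theorem stmt_6 (h k : ℝ) (hh : 0 < h) (hk1 : 1/2 < k) (hk2 : k < 1/2 + h)
    (hkh : k + h < 1)
    (π β γ Δ nab : ℝ)
    (hπ : π = 1/2 + (k - 1/2) / (2*h))
    (hβ : β = (1/2 + k + h) / 2)
    (hγ : γ = (1/2 + k - h) / 2)
    (hΔ : Δ = k + h - 1/2)
    (hnab : nab = 1/2 - k + h) :
    (k + (1 - π)*γ) / (1 + (1 - π)*γ + π*(1 - β)) <
      (k + (1 - π)*γ + π*Δ) / (1 + (1 - π)*γ + π*(1 - β) + π*Δ + (1 - π)*nab) := by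
  have hΔ0 : 0 < Δ := by linarith
  have hnab0 : 0 < nab := by linarith
  obtain rfl : k = 1/2 + (Δ - nab) / 2 := by linarith
  obtain rfl : h = (Δ + nab) / 2 := by linarith
  obtain rfl : β = (1 + Δ) / 2 := by linarith
  obtain rfl : γ = (1 - nab) / 2 := by linarith
  have hs : 0 < Δ + nab := by positivity
  obtain rfl : π = Δ / (Δ + nab) := by rw [hπ]; field_simp; ring
  have hcompl : 1 - Δ / (Δ + nab) = nab / (Δ + nab) := by field_simp; ring
  rw [hcompl]
  have h1 : 0 < 1 - (1 + Δ) / 2 := by linarith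
  have h2 : 0 < (1 - nab) / 2 := by linarith
  rw [div_lt_div_iff₀ (by positivity) (by positivity), ← sub_pos]
  have key := sq_mul_lt_sq_mul_of_add_lt_one hnab0 (by linarith : nab < Δ) (by linarith)
  have hpos := div_pos (sub_pos.2 key) (by positivity : 0 < 2 * (Δ + nab) ^ 2)
  convert hpos using 1
  field_simp
  ring
end

section
/- Let h > 0 and k be real numbers with 1/2 < k < 1/2 + h and k + h < 1. Define π = 1/2 + (k−1/2)/(2h), β = (1/2+k+h)/2, γ = (1/2+k−h)/2. Then (k + (1−π)γ) / (1 + (1−π)γ + π(1−β)) < k, i.e. the majority party's expected list vote share under PVT is strictly smaller than under DVT. -/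
/-- Uniform vote shares: expected list vote share under PVT is smaller than under DVT. -/
theorem stmt_8 (h k : ℝ) (hh : 0 < h) (hk1 : 1/2 < k) (hk2 : k < 1/2 + h)
    (hkh : k + h < 1)
    (π β γ : ℝ)
    (hπ : π = 1/2 + (k - 1/2) / (2*h))
    (hβ : β = (1/2 + k + h) / 2)
    (hγ : γ = (1/2 + k - h) / 2) :
    (k + (1 - π)*γ) / (1 + (1 - π)*γ + π*(1 - β)) < k := by
  obtain ⟨a, rfl⟩ : ∃ a, k = 1/2 + a := ⟨k - 1/2, by ring⟩
  have ha : 0 < a := by linarith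
  have hπ' : π = (h + a) / (2*h) := by
    rw [hπ]
    field_simp
    ring
  have hπ1 : 1 - π = (h - a) / (2*h) := by
    rw [hπ']
    field_simp
    ring
  have hπ_pos : 0 < π := hπ' ▸ by positivity
  have hπ1_pos : 0 < 1 - π := hπ1 ▸ div_pos (by linarith) (by positivity)
  have hγ_pos : 0 < γ := by linarith
  have hβ_pos : 0 < 1 - β := by linarith
  rw [div_lt_iff₀ (by positivity)]
  have key : (1/2 + a) * (1 + (1 - π)*γ + π*(1 - β)) - (1/2 + a + (1 - π)*γ)
      = a * (1/2 - h^2 - a^2) / (2*h) := by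
    rw [hπ1, hπ', hβ, hγ]
    field_simp
    ring
  have hsq : 0 < 1/2 - h^2 - a^2 := by nlinarith
  have : 0 < a * (1/2 - h^2 - a^2) / (2*h) := by positivity
  linarith
end

section
/- Let h = 1/6 and let k be a real number with 1/2 < k < 1/2 + h. Define π = 1/2 + (k−1/2)/(2h), β = (1/2+k+h)/2, γ = (1/2+k−h)/2. Then (k + (1−π)γ) / (1 + (1−π)γ + π(1−β)) = 1/2; that is, when h = 1/6, the majority party's expected list vote share under PVT equals exactly 1/2 for every expected vote share k. -/
/-- When h = 1/6, the expected list vote share under PVT is exactly 1/2 for every k. -/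
theorem stmt_9 (h k : ℝ) (hh : h = 1/6) (hk1 : 1/2 < k) (hk2 : k < 1/2 + h)
    (π β γ : ℝ)
    (hπ : π = 1/2 + (k - 1/2) / (2*h))
    (hβ : β = (1/2 + k + h) / 2)
    (hγ : γ = (1/2 + k - h) / 2) :
    (k + (1 - π)*γ) / (1 + (1 - π)*γ + π*(1 - β)) = 1/2 := by
  subst hh hπ hβ hγ
  have hpos : 0 < (2 - 3 * k) * (k + 1/3) :=
    mul_pos (by linarith) (by linarith)
  have hne : 1 + (1 - (1/2 + (k - 1/2) / (2 * (1/6)))) * ((1/2 + k - 1/6) / 2)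
      + (1/2 + (k - 1/2) / (2 * (1/6))) * (1 - (1/2 + k + 1/6) / 2) ≠ 0 := by
    apply ne_of_gt
    ring_nf at hpos ⊢
    linarith
  rw [div_eq_iff hne]
  ring
end

section
/- Let h > 0 and k be real numbers with 1/2 < k < 1/2 + h and k + h < 1. Define π = 1/2 + (k−1/2)/(2h), β = (1/2+k+h)/2, γ = (1/2+k−h)/2, and ℓ_PVT = (k + (1−π)γ) / (1 + (1−π)γ + π(1−β)). Then ℓ_PVT > 1/2 if and only if h > 1/6, ℓ_PVT = 1/2 if and only if h = 1/6, and ℓ_PVT < 1/2 if and only if h < 1/6. (Under PVT, the majority party's expected list vote share exceeds one half exactly when the district-level vote dispersion exceeds 1/6.) -/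
/-- ℓ_PVT exceeds (equals, is below) 1/2 exactly when h exceeds (equals, is below) 1/6. -/
theorem stmt_11 (h k : ℝ) (hh : 0 < h) (hk1 : 1/2 < k) (hk2 : k < 1/2 + h)
    (hkh : k + h < 1)
    (π β γ ℓPVT : ℝ)
    (hπ : π = 1/2 + (k - 1/2) / (2*h))
    (hβ : β = (1/2 + k + h) / 2)
    (hγ : γ = (1/2 + k - h) / 2)
    (hPVT : ℓPVT = (k + (1 - π)*γ) / (1 + (1 - π)*γ + π*(1 - β))) :
    (ℓPVT > 1/2 ↔ h > 1/6) ∧ (ℓPVT = 1/2 ↔ h = 1/6) ∧ (ℓPVT < 1/2 ↔ h < 1/6) := by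
  have hπ0 : 0 < π := by
    rw [hπ]
    have : 0 < (k - 1/2) / (2*h) := div_pos (by linarith) (by linarith)
    linarith
  have hπ1 : π < 1 := by
    have : (k - 1/2) / (2*h) < 1/2 := by
      rw [div_lt_iff₀ (by linarith)]
      linarith
    linarith
  have hD : 0 < 1 + (1 - π)*γ + π*(1 - β) := by
    have h₁ : 0 < (1 - π)*γ := mul_pos (by linarith) (by linarith)
    have h₂ : 0 < π*(1 - β) := mul_pos hπ0 (by linarith)
    linarith
  have hnum : 2*k - 1 + (1 - π)*γ - π*(1 - β) = (k - 1/2)*(6*h - 1) / (2*h) := by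
    rw [hπ, hβ, hγ]
    field_simp
    ring
  have hc : 0 < (k - 1/2) / (2*h) / (2*(1 + (1 - π)*γ + π*(1 - β))) :=
    div_pos (div_pos (by linarith) (by linarith)) (by linarith)
  have key : ℓPVT - 1/2 =
      (k - 1/2) / (2*h) / (2*(1 + (1 - π)*γ + π*(1 - β))) * (6*h - 1) := by
    calc ℓPVT - 1/2
        = (2*k - 1 + (1 - π)*γ - π*(1 - β)) / (2*(1 + (1 - π)*γ + π*(1 - β))) := by
          rw [hPVT, div_sub_div _ _ hD.ne' two_ne_zero, mul_comm _ (2 : ℝ)]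
          ring
      _ = _ := by
          rw [hnum]
          ring
  refine ⟨?_, ?_, ?_⟩
  · rw [gt_iff_lt, gt_iff_lt, ← sub_pos, key, mul_pos_iff_of_pos_left hc]
    constructor <;> intro <;> linarith
  · rw [← sub_eq_zero, key, mul_eq_zero, or_iff_right hc.ne']
    constructor <;> intro <;> linarith
  · rw [← sub_neg, key, ← neg_pos, ← mul_neg, mul_pos_iff_of_pos_left hc]
    constructor <;> intro <;> linarith
end

section
/- Let h > 0 and k be real numbers with 1/2 < k < 1/2 + h and k + h < 1. Define π = 1/2 + (k−1/2)/(2h), β = (1/2+k+h)/2, γ = (1/2+k−h)/2, Δ = k+h−1/2, ∇ = 1/2−k+h, and ℓ_NVT = (k + (1−π)γ + πΔ) / (1 + (1−π)γ + π(1−β) + πΔ + (1−π)∇). Then ℓ_NVT > 1/2 if and only if h > 1/10, ℓ_NVT = 1/2 if and only if h = 1/10, and ℓ_NVT < 1/2 if and only if h < 1/10. (Under NVT, the majority party's expected list vote share exceeds one half exactly when the district-level vote dispersion exceeds 1/10.) -/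
/-- ℓ_NVT exceeds (equals, is below) 1/2 exactly when h exceeds (equals, is below) 1/10. -/
theorem stmt_12 (h k : ℝ) (hh : 0 < h) (hk1 : 1/2 < k) (hk2 : k < 1/2 + h)
    (hkh : k + h < 1)
    (π β γ Δ nab ℓNVT : ℝ)
    (hπ : π = 1/2 + (k - 1/2) / (2*h))
    (hβ : β = (1/2 + k + h) / 2)
    (hγ : γ = (1/2 + k - h) / 2)
    (hΔ : Δ = k + h - 1/2)
    (hnab : nab = 1/2 - k + h)
    (hNVT : ℓNVT = (k + (1 - π)*γ + π*Δ) /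
      (1 + (1 - π)*γ + π*(1 - β) + π*Δ + (1 - π)*nab)) :
    (ℓNVT > 1/2 ↔ h > 1/10) ∧ (ℓNVT = 1/2 ↔ h = 1/10) ∧ (ℓNVT < 1/2 ↔ h < 1/10) := by
  have hπ0 : 0 < π := by
    have : 0 < (k - 1/2) / (2*h) := div_pos (by linarith) (by linarith)
    linarith
  have hπ1 : π < 1 := by
    have : (k - 1/2) / (2*h) < 1/2 := by
      rw [div_lt_iff₀ (by linarith)]
      linarith
    linarith
  have hπh : 2 * h * π = h + (k - 1/2) := by
    rw [hπ]
    field_simp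
  set D := 1 + (1 - π)*γ + π*(1 - β) + π*Δ + (1 - π)*nab with hD
  have hDpos : 0 < D := by
    have h1 : 0 < (1 - π)*γ := mul_pos (by linarith) (by linarith)
    have h2 : 0 < π*(1 - β) := mul_pos hπ0 (by linarith)
    have h3 : 0 < π*Δ := mul_pos hπ0 (by linarith)
    have h4 : 0 < (1 - π)*nab := mul_pos (by linarith) (by linarith)
    linarith
  have key : ℓNVT - 1/2 = (k - 1/2) / (4*h*D) * (10*h - 1) := by
    have hnum : 2*h*(2*(k + (1 - π)*γ + π*Δ) - D) = (k - 1/2) * (10*h - 1) := by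
      rw [hD, hβ, hγ, hΔ, hnab]
      linear_combination (3*h - 1) * hπh
    have hne : h ≠ 0 := hh.ne'
    have hDne : D ≠ 0 := hDpos.ne'
    rw [hNVT, div_mul_eq_mul_div, ← hnum]
    field_simp
    ring
  have hc : 0 < (k - 1/2) / (4*h*D) := div_pos (by linarith) (by positivity)
  refine ⟨?_, ?_, ?_⟩
  · rw [gt_iff_lt, ← sub_pos, key, mul_pos_iff_of_pos_left hc]
    constructor <;> intro <;> linarith
  · rw [← sub_eq_zero, key, mul_eq_zero, or_iff_right hc.ne']
    constructor <;> intro <;> linarith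
  · rw [← sub_neg, key, ← neg_pos, ← mul_neg, mul_pos_iff_of_pos_left hc]
    constructor <;> intro <;> linarith
end

section
/- Let x be a real number with 1/2 < x < 1 and let α be a real number with 0 ≤ α ≤ 1. Define the spread of seat share between the two extreme scenarios for each formula as D_DVT = 2α(1−x), D_PVT = 2α(1−x) − (1−α)(1−x)/(2−x), and D_NVT = 2α(1−x) − (1−α)(1−x)/(1+x). Then D_PVT ≤ D_NVT ≤ D_DVT, with strict inequalities whenever α < 1. (The gap between the majority party's seat shares in the best and worst extreme scenarios is largest under DVT and smallest under PVT.) -/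
/-- The spread of seat share between the two extreme scenarios is largest under DVT
and smallest under PVT. -/
theorem stmt_16 (x α : ℝ) (hx1 : 1/2 < x) (hx2 : x < 1) (hα0 : 0 ≤ α) (hα1 : α ≤ 1)
    (DDVT DPVT DNVT : ℝ)
    (hD : DDVT = 2*α*(1 - x))
    (hP : DPVT = 2*α*(1 - x) - (1 - α)*(1 - x)/(2 - x))
    (hN : DNVT = 2*α*(1 - x) - (1 - α)*(1 - x)/(1 + x)) :
    DPVT ≤ DNVT ∧ DNVT ≤ DDVT ∧ (α < 1 → DPVT < DNVT ∧ DNVT < DDVT) := by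
  subst hD hP hN
  have h1x : 0 < 1 - x := by linarith
  have hden : 2 - x < 1 + x := by linarith
  have h2x : 0 < 2 - x := by linarith
  have hpos : 0 < 1 + x := by linarith
  have hnum : 0 ≤ (1 - α) * (1 - x) := mul_nonneg (by linarith) h1x.le
  refine ⟨?_, ?_, fun hα => ?_⟩
  · exact sub_le_sub_left (div_le_div_of_nonneg_left hnum h2x hden.le) _
  · exact sub_le_self _ (div_nonneg hnum hpos.le)
  · have hnum' : 0 < (1 - α) * (1 - x) := mul_pos (by linarith) h1x
    exact ⟨sub_lt_sub_left (div_lt_div_of_pos_left hnum' h2x hden) _,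
      sub_lt_self _ (div_pos hnum' hpos)⟩
end
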